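/- Let p ≥ 2, a = 1/p, π_p = 2π/(p sin(π/p)), and artanh_p(x) = ∫₀^x (1-t^p)^{-1} dt. Then for every r ∈ (0,1): (π/2)·(artanh_p(r)/r)^{1/2} < (π/2)·(1 - ((p-1)/p²)·log(1-r²)) < 𝒦_a(r) < (π/2)·(1 - (2/(p·π_p))·log(1-r²)). -/

import Mathlib

open Real Set

/-- Shifted factorial (Pochhammer/Appell symbol) `(a)ₙ`. -/
noncomputable def shiftedFact (a : ℝ) : ℕ → ℝ
  | 0 => 1
  | n + 1 => shiftedFact a n * (a + n)

/-- Gaussian hypergeometric function `F(a,b;c;x)` as a series. -/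
noncomputable def hypF (a b c x : ℝ) : ℝ :=
  ∑' n : ℕ, shiftedFact a n * shiftedFact b n / (shiftedFact c n * (Nat.factorial n : ℝ)) * x ^ n

/-- Generalized complete elliptic integral of the first kind `𝒦ₐ(r)`. -/
noncomputable def ellK (a r : ℝ) : ℝ := (Real.pi / 2) * hypF a (1 - a) 1 (r ^ 2)

/-- Generalized complete elliptic integral of the second kind `ℰₐ(r)`. -/
noncomputable def ellE (a r : ℝ) : ℝ := (Real.pi / 2) * hypF (a - 1) (1 - a) 1 (r ^ 2)

/-- The generalized Grötzsch modulus `μₐ(r)`. -/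
noncomputable def muFn (a r : ℝ) : ℝ :=
  Real.pi / (2 * Real.sin (Real.pi * a)) * ellK a (Real.sqrt (1 - r ^ 2)) / ellK a r

/-- Inverse of `μₐ` (on `(0,1)`, where it is a decreasing homeomorphism onto `(0,∞)`). -/
noncomputable def muInv (a : ℝ) : ℝ → ℝ := Function.invFunOn (muFn a) (Set.Ioo 0 1)

/-- The generalized modular function `φ_K^a(r)`. -/
noncomputable def phiK (a K r : ℝ) : ℝ := muInv a (muFn a r / K)

/-- `η_K^a(x) = (s/s')²` where `s = φ_K^a(√(x/(1+x)))`. -/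
noncomputable def etaK (a K x : ℝ) : ℝ :=
  ((phiK a K (Real.sqrt (x / (1 + x)))) / Real.sqrt (1 - (phiK a K (Real.sqrt (x / (1 + x)))) ^ 2)) ^ 2

/-- `λₐ(K)`. -/
noncomputable def lambdaA (a K : ℝ) : ℝ :=
  (phiK a K (1 / Real.sqrt 2) / phiK a (1 / K) (1 / Real.sqrt 2)) ^ 2

/-- The generalized inverse hyperbolic tangent `artanh_p`. -/
noncomputable def artanhp (p x : ℝ) : ℝ := ∫ t in (0:ℝ)..x, (1 - t ^ p)⁻¹

/-- The inverse hyperbolic tangent. -/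
noncomputable def artanh (x : ℝ) : ℝ := (1 / 2) * Real.log ((1 + x) / (1 - x))

/-- Euler beta function. -/
noncomputable def betaB (x y : ℝ) : ℝ := Real.Gamma x * Real.Gamma y / Real.Gamma (x + y)

/-- `μ_{a,c}(r)`, the two-parameter generalized modulus. -/
noncomputable def muAC (a c r : ℝ) : ℝ :=
  betaB a (c - a) * hypF a (c - a) c (1 - r ^ 2) / (2 * hypF a (c - a) c (r ^ 2))

/-- Inverse of `μ_{a,c}` on `(0,1)`. -/
noncomputable def muACInv (a c : ℝ) : ℝ → ℝ := Function.invFunOn (muAC a c) (Set.Ioo 0 1)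

/-- The modular function `φ_K^{a,c}(r)`. -/
noncomputable def phiAC (a c K r : ℝ) : ℝ := muACInv a c (muAC a c r / K)

lemma shiftedFact_one' (n : ℕ) : shiftedFact 1 n = (Nat.factorial n : ℝ) := by
  induction n with
  | zero => simp [shiftedFact]
  | succ k ih => rw [shiftedFact, ih, Nat.factorial_succ]; push_cast; ring

lemma shiftedFact_prod (a : ℝ) (n : ℕ) :
    shiftedFact a n = ∏ j ∈ Finset.range n, (a + (j : ℝ)) := by
  induction n with
  | zero => simp [shiftedFact]
  | succ k ih => rw [shiftedFact, ih, Finset.prod_range_succ]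

lemma shiftedFact_pos' (a : ℝ) (ha : 0 < a) (n : ℕ) : 0 < shiftedFact a n := by
  rw [shiftedFact_prod]
  exact Finset.prod_pos fun j _ => by positivity

/-- `(n+1) c_{n+1}`. -/
noncomputable def dco (a : ℝ) (n : ℕ) : ℝ :=
  ((n : ℝ) + 1) * (shiftedFact a (n+1) * shiftedFact (1-a) (n+1) /
    (shiftedFact 1 (n+1) * (Nat.factorial (n+1) : ℝ)))

lemma dco_zero (a : ℝ) : dco a 0 = a * (1 - a) := by
  simp [dco, shiftedFact]

lemma dco_pos (a : ℝ) (h0 : 0 < a) (h1 : a < 1) (n : ℕ) : 0 < dco a n := by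
  have := shiftedFact_pos' a h0 (n+1)
  have := shiftedFact_pos' (1-a) (by linarith) (n+1)
  have := shiftedFact_pos' 1 one_pos (n+1)
  unfold dco
  positivity

lemma dco_succ (a : ℝ) (n : ℕ) :
    dco a (n+1) = dco a n * ((n + 1 + a) * (n + 1 + (1 - a)) / ((n + 1) * (n + 2))) := by
  unfold dco
  rw [shiftedFact_one', shiftedFact_one', shiftedFact, shiftedFact.eq_2 (1-a) (n+1),
    Nat.factorial_succ (n+1)]
  have : (Nat.factorial (n+1) : ℝ) ≠ 0 := by positivity
  have h1 : (n : ℝ) + 1 ≠ 0 := by positivity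
  have h2 : (n : ℝ) + 2 ≠ 0 := by positivity
  have h3 : (n : ℝ) + 1 + 1 ≠ 0 := by positivity
  push_cast
  field_simp
  ring

lemma dco_strictMono (a : ℝ) (h0 : 0 < a) (h1 : a < 1) : StrictMono (dco a) := by
  apply strictMono_nat_of_lt_succ
  intro n
  rw [dco_succ]
  apply lt_mul_of_one_lt_right (dco_pos a h0 h1 n)
  rw [one_lt_div (by positivity)]
  nlinarith [mul_pos h0 (sub_pos.2 h1)]

lemma dco_tendsto (a : ℝ) (h0 : 0 < a) (h1 : a < 1) :
    Filter.Tendsto (dco a) Filter.atTop (nhds (Real.sin (Real.pi * a) / Real.pi)) := by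
  have hG : Filter.Tendsto (fun n : ℕ => ((n : ℝ) / (n + 1)) *
      (Real.GammaSeq a n * Real.GammaSeq (1-a) n)⁻¹) Filter.atTop
      (nhds (1 * (Real.Gamma a * Real.Gamma (1-a))⁻¹)) := by
    apply Filter.Tendsto.mul (tendsto_natCast_div_add_atTop (1:ℝ))
    apply Filter.Tendsto.inv₀
    · exact (Real.GammaSeq_tendsto_Gamma a).mul (Real.GammaSeq_tendsto_Gamma (1-a))
    · have := Real.Gamma_pos_of_pos h0
      have := Real.Gamma_pos_of_pos (sub_pos.2 h1)
      positivity
  rw [Real.Gamma_mul_Gamma_one_sub, inv_div, one_mul] at hG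
  refine hG.congr' ?_
  filter_upwards [Filter.eventually_gt_atTop 0] with n hn
  have hn' : (0:ℝ) < n := by exact_mod_cast hn
  unfold dco Real.GammaSeq
  rw [← shiftedFact_prod, ← shiftedFact_prod, shiftedFact_one', Nat.factorial_succ]
  have e : (n:ℝ) ^ (1-a) = n / (n:ℝ)^a := by rw [Real.rpow_sub hn', Real.rpow_one]
  rw [e]
  have := (shiftedFact_pos' a h0 (n+1)).ne'
  have := (shiftedFact_pos' (1-a) (by linarith) (n+1)).ne'
  have : (n:ℝ)^a ≠ 0 := by positivity
  have : (Nat.factorial n : ℝ) ≠ 0 := by positivity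
  have h1 : (n : ℝ) + 1 ≠ 0 := by positivity
  push_cast
  field_simp

lemma dco_lt (a : ℝ) (h0 : 0 < a) (h1 : a < 1) (n : ℕ) :
    dco a n < Real.sin (Real.pi * a) / Real.pi :=
  lt_of_lt_of_le (dco_strictMono a h0 h1 (Nat.lt_succ_self n))
    ((dco_strictMono a h0 h1).monotone.ge_of_tendsto (dco_tendsto a h0 h1) _)

lemma hypF_bounds (a x : ℝ) (h0 : 0 < a) (h1 : a < 1) (hx0 : 0 < x) (hx1 : x < 1) :
    1 - a * (1 - a) * Real.log (1 - x) < hypF a (1-a) 1 x ∧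
    hypF a (1-a) 1 x < 1 - Real.sin (Real.pi * a) / Real.pi * Real.log (1 - x) := by
  have hs := Real.hasSum_pow_div_log_of_abs_lt_one (x := x) (by rw [abs_of_pos hx0]; exact hx1)
  set S := Real.sin (Real.pi * a) / Real.pi
  have hterm : ∀ n : ℕ, 0 < x ^ (n+1) / ((n:ℝ)+1) := fun n => by positivity
  have hA := hs.mul_left (a * (1-a))
  have hB := hs.mul_left S
  have hC : Summable (fun n : ℕ => dco a n * (x ^ (n+1) / ((n:ℝ)+1))) :=
    Summable.of_nonneg_of_le (fun n => (mul_pos (dco_pos a h0 h1 n) (hterm n)).le)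
      (fun n => mul_le_mul_of_nonneg_right (dco_lt a h0 h1 n).le (hterm n).le) hB.summable
  have he : ∀ n : ℕ, shiftedFact a (n+1) * shiftedFact (1-a) (n+1) /
      (shiftedFact 1 (n+1) * (Nat.factorial (n+1) : ℝ)) * x ^ (n+1)
      = dco a n * (x ^ (n+1) / ((n:ℝ)+1)) := by
    intro n
    have h1 : (n : ℝ) + 1 ≠ 0 := by positivity
    unfold dco
    field_simp
  have hF : hypF a (1-a) 1 x = 1 + ∑' n : ℕ, dco a n * (x ^ (n+1) / ((n:ℝ)+1)) := by
    unfold hypF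
    rw [Summable.tsum_eq_zero_add]
    · simp only [he]
      simp [shiftedFact]
    · rw [← summable_nat_add_iff 1]
      simpa only [he] using hC
  rw [hF]
  constructor
  · have := Summable.tsum_lt_tsum (i := 1) (f := fun n : ℕ => a*(1-a) * (x ^ (n+1) / ((n:ℝ)+1)))
      (g := fun n : ℕ => dco a n * (x ^ (n+1) / ((n:ℝ)+1)))
      (fun n => by
        have := (dco_strictMono a h0 h1).monotone (Nat.zero_le n)
        rw [dco_zero] at this
        exact mul_le_mul_of_nonneg_right this (hterm n).le)
      (by
        have := (dco_strictMono a h0 h1) Nat.zero_lt_one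
        rw [dco_zero] at this
        exact mul_lt_mul_of_pos_right this (hterm 1)) hA.summable hC
    rw [hA.tsum_eq] at this
    linarith
  · have := Summable.tsum_lt_tsum (i := 0) (f := fun n : ℕ => dco a n * (x ^ (n+1) / ((n:ℝ)+1)))
      (g := fun n : ℕ => S * (x ^ (n+1) / ((n:ℝ)+1)))
      (fun n => mul_le_mul_of_nonneg_right (dco_lt a h0 h1 n).le (hterm n).le)
      (mul_lt_mul_of_pos_right (dco_lt a h0 h1 0) (hterm 0)) hC hB.summable
    rw [hB.tsum_eq] at this
    linarith

lemma integrand_le (p t : ℝ) (hp : 2 ≤ p) (ht0 : 0 < t) (ht1 : t < 1) :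
    (1 - t ^ p)⁻¹ ≤ 1 + 2 / p * (t^2 / (1 - t^2)) := by
  have hx : 0 < 1 - t^2 := by nlinarith
  have hy0 : 0 < t ^ p := Real.rpow_pos_of_pos ht0 p
  have hb := one_add_mul_self_le_rpow_one_add (s := (t^2)⁻¹ - 1) (p := p/2)
    (by have : 0 < (t^2)⁻¹ := by positivity
        linarith) (by linarith)
  have e : (1 + ((t^2)⁻¹ - 1)) ^ (p/2) = (t^p)⁻¹ := by
    rw [add_sub_cancel, Real.inv_rpow (by positivity), ← Real.rpow_natCast, ← Real.rpow_mul ht0.le]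
    congr 2; push_cast; ring
  rw [e] at hb
  set y := t ^ p
  have hk : 0 < p/2 * ((t^2)⁻¹ - 1) := by
    have : 1 < (t^2)⁻¹ := (one_lt_inv₀ (by positivity)).2 (by linarith)
    have : 0 < (t^2)⁻¹ - 1 := by linarith
    positivity
  have hy1 : 0 < y⁻¹ - 1 := by linarith
  have e1 : (1 - y)⁻¹ = 1 + (y⁻¹ - 1)⁻¹ := by
    have : 1 - y ≠ 0 := by
      intro h
      have : y = 1 := by linarith
      rw [this] at hy1; norm_num at hy1
    have h2 : y⁻¹ - 1 = (1-y)/y := by field_simp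
    rw [h2]; field_simp; ring
  have e2 : 2 / p * (t^2 / (1 - t^2)) = (p/2 * ((t^2)⁻¹ - 1))⁻¹ := by
    have h2 : (t^2)⁻¹ - 1 = (1-t^2)/t^2 := by field_simp
    rw [h2]; field_simp
  rw [e1, e2]
  have := inv_anti₀ hk (show p/2 * ((t^2)⁻¹ - 1) ≤ y⁻¹ - 1 by linarith)
  linarith

lemma artanhp_lt (p r : ℝ) (hp : 2 ≤ p) (hr0 : 0 < r) (hr1 : r < 1) :
    artanhp p r < r * (1 - 1/p * Real.log (1 - r^2)) := by
  have hp0 : 0 < p := by linarith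
  have hne : ∀ t ∈ Set.Icc (0:ℝ) r, 0 < 1 - t^2 := fun t ht => by
    nlinarith [ht.1, ht.2]
  have hne' : ∀ t ∈ Set.Icc (0:ℝ) r, 1 - t^p ≠ 0 := fun t ht => by
    have := Real.rpow_lt_one ht.1 (lt_of_le_of_lt ht.2 hr1) hp0
    linarith
  let g' : ℝ → ℝ := fun t => 1 - 1/p * Real.log (1 - t^2) + 2 / p * (t^2 / (1 - t^2))
  have hg' : ContinuousOn g' (Set.Icc 0 r) := by
    have c1 : ContinuousOn (fun t : ℝ => 1 - t^2) (Set.Icc 0 r) := by fun_prop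
    have c2 := c1.log (fun t ht => (hne t ht).ne')
    have c3 : ContinuousOn (fun t : ℝ => t^2 / (1 - t^2)) (Set.Icc 0 r) :=
      ContinuousOn.div (by fun_prop) c1 (fun t ht => (hne t ht).ne')
    exact (continuousOn_const.sub (continuousOn_const.mul c2)).add (continuousOn_const.mul c3)
  have hf : ContinuousOn (fun t : ℝ => (1 - t^p)⁻¹) (Set.Icc 0 r) := by
    apply ContinuousOn.inv₀ _ hne'
    exact continuousOn_const.sub (Real.continuous_rpow_const hp0.le).continuousOn
  have hlog : ∀ t : ℝ, 0 < t → t ≤ r → Real.log (1 - t^2) < 0 := fun t h0 h1 =>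
    Real.log_neg (hne t ⟨h0.le, h1⟩) (by nlinarith)
  have hlt : ∀ t ∈ Set.Ioc (0:ℝ) r, (1 - t^p)⁻¹ < g' t := fun t ht => by
    have h1 := integrand_le p t hp ht.1 (lt_of_le_of_lt ht.2 hr1)
    have h2 : 0 < 1/p * -Real.log (1 - t^2) := by
      have := hlog t ht.1 ht.2
      have : 0 < -Real.log (1 - t^2) := by linarith
      positivity
    simp only [g']
    linarith
  have hint := intervalIntegral.integral_lt_integral_of_continuousOn_of_le_of_exists_lt hr0 hf hg'
    (fun t ht => (hlt t ht).le) ⟨r, ⟨hr0.le, le_rfl⟩, hlt r ⟨hr0, le_rfl⟩⟩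
  have hd : ∫ t in (0:ℝ)..r, g' t = r * (1 - 1/p * Real.log (1 - r^2)) -
      0 * (1 - 1/p * Real.log (1 - 0^2)) := by
    apply intervalIntegral.integral_eq_sub_of_hasDerivAt
      (f := fun r : ℝ => r * (1 - 1/p * Real.log (1 - r^2)))
    · intro t ht
      rw [Set.uIcc_of_le hr0.le] at ht
      have h := hne t ht
      have d1 : HasDerivAt (fun t : ℝ => 1 - t^2) (-(2*t)) t := by
        simpa using (hasDerivAt_pow 2 t).const_sub 1
      have d2 := ((d1.log h.ne').const_mul (1/p)).const_sub 1
      have d3 := (hasDerivAt_id t).mul d2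
      refine d3.congr_deriv ?_
      simp only [g', id]
      field_simp
    · exact ContinuousOn.intervalIntegrable (by rwa [Set.uIcc_of_le hr0.le])
  unfold artanhp
  rw [hd] at hint
  linarith

theorem stmt2 (p : ℝ) (hp : 2 ≤ p) (r : ℝ) (hr : r ∈ Set.Ioo (0:ℝ) 1) :
    Real.pi / 2 * (artanhp p r / r) ^ ((1:ℝ) / 2) <
      Real.pi / 2 * (1 - (p - 1) / p ^ 2 * Real.log (1 - r ^ 2)) ∧
    Real.pi / 2 * (1 - (p - 1) / p ^ 2 * Real.log (1 - r ^ 2)) < ellK (1 / p) r ∧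
    ellK (1 / p) r <
      Real.pi / 2 * (1 - 2 / (p * (2 * Real.pi / (p * Real.sin (Real.pi / p)))) *
        Real.log (1 - r ^ 2)) := by
  obtain ⟨hr0, hr1⟩ := hr
  have hp0 : 0 < p := by linarith
  have ha0 : 0 < 1/p := by positivity
  have ha1 : 1/p < 1 := by rw [div_lt_one hp0]; linarith
  have hx0 : 0 < r^2 := by positivity
  have hx1 : r^2 < 1 := by nlinarith
  have hpi := Real.pi_pos
  have hL : Real.log (1 - r^2) < 0 := Real.log_neg (by linarith) (by linarith)
  have hc : (p - 1)/p^2 = 1/p * (1 - 1/p) := by field_simp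
  obtain ⟨hb1, hb2⟩ := hypF_bounds (1/p) (r^2) ha0 ha1 hx0 hx1
  refine ⟨?_, ?_, ?_⟩
  · apply mul_lt_mul_of_pos_left _ (by positivity)
    rw [← Real.sqrt_eq_rpow, hc]
    have h1 : artanhp p r / r < 1 - 1/p * Real.log (1 - r^2) := by
      rw [div_lt_iff₀ hr0, mul_comm]
      exact artanhp_lt p r hp hr0 hr1
    have ha2 : 1/p ≤ 1/2 := one_div_le_one_div_of_le two_pos hp
    have hm : 0 < 1/p * -Real.log (1 - r^2) := mul_pos ha0 (by linarith)
    have hq : 0 < (1 - 1/p) * (1/p * -Real.log (1 - r^2)) := mul_pos (by linarith) hm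
    rw [Real.sqrt_lt' (by nlinarith)]
    nlinarith [mul_nonneg (show 0 ≤ 1/2 - 1/p by linarith) hm.le]
  · unfold ellK
    apply mul_lt_mul_of_pos_left _ (by positivity)
    rw [hc]; exact hb1
  · unfold ellK
    apply mul_lt_mul_of_pos_left _ (by positivity)
    have e : 2 / (p * (2 * Real.pi / (p * Real.sin (Real.pi / p)))) =
        Real.sin (Real.pi * (1/p)) / Real.pi := by
      rw [mul_one_div]
      have : Real.sin (Real.pi / p) ≠ 0 := by
        apply ne_of_gt
        apply Real.sin_pos_of_pos_of_lt_pi (by positivity)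
        rw [div_lt_iff₀ hp0]; nlinarith
      field_simp
    rw [e]; exact hb2
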